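/- Suppose that: (i) there exists T̊ > 0 such that F̄(0,0,T) = 0 for all T ∈ (0,T̊); (ii) there exists T̂ > 0 such that for every ε > 0 there exists δ > 0 with |F̄(x,e,T)| < ε whenever |x| ≤ δ, |e| ≤ δ and T ∈ (0,T̂); (iii) there exist C : ℝ≥0 × ℝ≥0 → ℝ>0 nondecreasing in each variable and Ť : ℝ≥0 × ℝ≥0 → ℝ>0 nonincreasing in each variable such that |F̄(x,e,T)| ≤ C(M,E) whenever |x| ≤ M, |e| ≤ E and T ∈ (0,Ť(M,E)); and (iv) there exist α₁, α₂, α₃ of class K∞ and ρ of class K such that for every M ≥ 0 and E ≥ 0 there exist T̃ = T̃(M,E) > 0 and V = V_{M,E} : ℝⁿ → ℝ≥0 ∪ {∞} with α₁(|x|) ≤ V(x) for all x ∈ ℝⁿ, V(x) ≤ α₂(|x|) for all |x| ≤ M, and V(F̄(x,e,T)) − V(x) ≤ −T·α₃(|x|) whenever ρ(|e|) ≤ |x| ≤ M, |e| ≤ E and T ∈ (0,T̃), where T̃ can be taken nonincreasing in each variable. Then the system x_{k+1} = F̄(x_k, e_k, T_k) is S-ISS-VSR. -/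

import Mathlib

open scoped BigOperators

/-- A class-`K` function: continuous, strictly increasing on `[0,∞)` and zero at zero. -/
def ClassK (f : ℝ → ℝ) : Prop :=
  ContinuousOn f (Set.Ici 0) ∧ StrictMonoOn f (Set.Ici 0) ∧ f 0 = 0

/-- A class-`K∞` function: class `K` and unbounded. -/
def ClassKInf (f : ℝ → ℝ) : Prop :=
  ClassK f ∧ Filter.Tendsto f Filter.atTop Filter.atTop

/-- A class-`KL` function. -/
def ClassKL (β : ℝ → ℝ → ℝ) : Prop :=
  (∀ t, 0 ≤ t → ContinuousOn (fun s => β s t) (Set.Ici 0) ∧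
      StrictMonoOn (fun s => β s t) (Set.Ici 0) ∧ β 0 t = 0) ∧
  (∀ s, 0 < s → StrictAntiOn (fun t => β s t) (Set.Ici 0) ∧
      Filter.Tendsto (fun t => β s t) Filter.atTop (nhds 0))

/-- Semiglobal input-to-state stability under varying sampling rate (S-ISS-VSR) of
`x_{k+1} = F (x_k) (e_k) (T_k)`. -/
def SISSVSR {X Q : Type*} [NormedAddCommGroup X] [NormedAddCommGroup Q]
    (F : X → Q → ℝ → X) : Prop :=
  ∃ β : ℝ → ℝ → ℝ, ∃ γ : ℝ → ℝ, ClassKL β ∧ ClassKInf γ ∧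
    ∀ M, 0 ≤ M → ∀ Eb, 0 ≤ Eb → ∃ Tstar, 0 < Tstar ∧
      ∀ (x : ℕ → X) (e : ℕ → Q) (T : ℕ → ℝ),
        (∀ k, x (k + 1) = F (x k) (e k) (T k)) →
        ‖x 0‖ ≤ M → (∀ i, ‖e i‖ ≤ Eb) → (∀ i, 0 < T i ∧ T i < Tstar) →
        ∀ k, ‖x k‖ ≤ β ‖x 0‖ (∑ i ∈ Finset.range k, T i) +
          γ (⨆ i ∈ Finset.range k, ‖e i‖)


lemma ClassK.nonneg' {f : ℝ → ℝ} (hf : ClassK f) {x : ℝ} (hx : 0 ≤ x) : 0 ≤ f x := by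
  have := hf.2.1.monotoneOn (Set.mem_Ici.2 le_rfl) (Set.mem_Ici.2 hx) hx
  rwa [hf.2.2] at this

lemma ClassK.mono' {f : ℝ → ℝ} (hf : ClassK f) {x y : ℝ} (hx : 0 ≤ x) (h : x ≤ y) : f x ≤ f y :=
  hf.2.1.monotoneOn (Set.mem_Ici.2 hx) (Set.mem_Ici.2 (hx.trans h)) h

lemma ClassK.comp' {f g : ℝ → ℝ} (hf : ClassK f) (hg : ClassK g) : ClassK (fun x => f (g x)) := by
  have hm : Set.MapsTo g (Set.Ici 0) (Set.Ici 0) := fun x hx => hg.nonneg' hx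
  refine ⟨hf.1.comp hg.1 hm, hf.2.1.comp hg.2.1 hm, ?_⟩
  simp [hg.2.2, hf.2.2]

lemma ClassKInf.comp' {f g : ℝ → ℝ} (hf : ClassKInf f) (hg : ClassKInf g) :
    ClassKInf (fun x => f (g x)) := ⟨hf.1.comp' hg.1, hf.2.comp hg.2⟩

lemma ClassKInf.inverse' {f : ℝ → ℝ} (hf : ClassKInf f) :
    ∃ g : ℝ → ℝ, ClassKInf g ∧ (∀ y, 0 ≤ y → 0 ≤ g y ∧ f (g y) = y) ∧
      (∀ x, 0 ≤ x → g (f x) = x) := by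
  let F : Set.Ici (0:ℝ) → Set.Ici (0:ℝ) := fun x => ⟨f x, hf.1.nonneg' x.2⟩
  have hF : StrictMono F := fun a b h => hf.1.2.1 a.2 b.2 h
  have hs : Function.Surjective F := by
    rintro ⟨y, hy⟩
    have hy : 0 ≤ y := hy
    obtain ⟨b, hb, hb0⟩ := ((hf.2.eventually_ge_atTop y).and (Filter.eventually_ge_atTop 0)).exists
    have := intermediate_value_Icc hb0 (hf.1.1.mono Set.Icc_subset_Ici_self)
    obtain ⟨x, hx, hxy⟩ := this ⟨by rw [hf.1.2.2]; exact hy, hb⟩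
    exact ⟨⟨x, hx.1⟩, Subtype.ext hxy⟩
  let e := hF.orderIsoOfSurjective F hs
  have he : ∀ x, e x = F x := fun x => rfl
  let g : ℝ → ℝ := fun y => (e.symm ⟨max y 0, Set.mem_Ici.2 (le_max_right _ _)⟩ : Set.Ici (0:ℝ))
  have h1 : ∀ y, 0 ≤ y → 0 ≤ g y ∧ f (g y) = y := by
    intro y hy
    refine ⟨(e.symm ⟨max y 0, Set.mem_Ici.2 (le_max_right _ _)⟩).2, ?_⟩
    have := congrArg Subtype.val (e.apply_symm_apply ⟨max y 0, Set.mem_Ici.2 (le_max_right _ _)⟩)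
    simp only [he, F] at this
    exact this.trans (max_eq_left hy)
  have h2 : ∀ x, 0 ≤ x → g (f x) = x := fun x hx =>
    hf.1.2.1.injOn (h1 _ (hf.1.nonneg' hx)).1 hx (h1 _ (hf.1.nonneg' hx)).2
  have hmono : StrictMonoOn g (Set.Ici 0) := by
    intro a ha b hb hab
    by_contra hc
    push Not at hc
    have := hf.1.mono' (h1 b hb).1 hc
    rw [(h1 a ha).2, (h1 b hb).2] at this
    linarith
  have hc : Continuous g := by
    refine continuous_subtype_val.comp (e.symm.continuous.comp ?_)
    fun_prop
  refine ⟨g, ⟨⟨hc.continuousOn, hmono, ?_⟩, ?_⟩, h1, h2⟩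
  · have := h2 0 le_rfl
    rwa [hf.1.2.2] at this
  · rw [Filter.tendsto_atTop]
    intro b
    filter_upwards [Filter.eventually_ge_atTop (f (max b 0))] with y hy
    have := hmono.monotoneOn (hf.1.nonneg' (le_max_right b 0))
      ((hf.1.nonneg' (le_max_right b 0)).trans hy) hy
    rw [h2 _ (le_max_right _ _)] at this
    exact (le_max_left _ _).trans this

lemma exists_kinf_bound (P : ℝ → ℝ → Prop)
    (hb : ∀ s, 0 ≤ s → ∃ B, ∀ s' r, 0 ≤ s' → s' ≤ s → P s' r → r ≤ B)
    (h0 : ∀ ε, 0 < ε → ∃ δ, 0 < δ ∧ ∀ s' r, 0 ≤ s' → s' ≤ δ → P s' r → r ≤ ε) :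
    ∃ ζ, ClassKInf ζ ∧ ∀ s r, 0 ≤ s → P s r → r ≤ ζ s := by
  let S : ℝ → Set ℝ := fun s => insert 0 {r | ∃ s', 0 ≤ s' ∧ s' ≤ s ∧ P s' r}
  let h : ℝ → ℝ := fun s => sSup (S s)
  have hS : ∀ s, BddAbove (S s) := by
    intro s
    refine BddAbove.insert _ ?_
    obtain ⟨B, hB⟩ := hb (max s 0) (le_max_right _ _)
    exact ⟨B, fun r ⟨s', h1, h2, h3⟩ => hB s' r h1 (h2.trans (le_max_left _ _)) h3⟩
  have hne : ∀ s, (S s).Nonempty := fun s => ⟨0, Set.mem_insert _ _⟩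
  have hm : Monotone h := fun a b hab => csSup_le_csSup (hS b) (hne a)
    (Set.insert_subset_insert fun r ⟨s', h1, h2, h3⟩ => ⟨s', h1, h2.trans hab, h3⟩)
  have hpos : ∀ s, 0 ≤ h s := fun s => le_csSup (hS s) (Set.mem_insert _ _)
  have hle : ∀ s r, 0 ≤ s → P s r → r ≤ h s := fun s r hs hp =>
    le_csSup (hS s) (Set.mem_insert_of_mem _ ⟨s, hs, le_rfl, hp⟩)
  have hsm : ∀ ε, 0 < ε → ∃ δ, 0 < δ ∧ h δ ≤ ε := by
    intro ε hε
    obtain ⟨δ, hδ, H⟩ := h0 ε hε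
    refine ⟨δ, hδ, csSup_le (hne _) ?_⟩
    rintro r (rfl | ⟨s', h1, h2, h3⟩)
    · exact hε.le
    · exact H s' r h1 h2 h3
  have hh0 : h 0 = 0 := by
    refine le_antisymm (le_of_forall_pos_le_add fun ε hε => ?_) (hpos 0)
    obtain ⟨δ, hδ, H⟩ := hsm ε hε
    have := hm hδ.le
    linarith
  have hms : ∀ s, 0 ≤ s → Monotone (fun u => h (s * u)) := fun s hs a b hab =>
    hm (mul_le_mul_of_nonneg_left hab hs)
  have hint : ∀ s, 0 ≤ s → IntervalIntegrable (fun u => h (s * u)) MeasureTheory.volume 1 2 :=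
    fun s hs => (hms s hs).intervalIntegrable
  let I : ℝ → ℝ := fun s => ∫ u in (1:ℝ)..2, h (s * u)
  have hIm : ∀ a b, 0 ≤ a → a ≤ b → I a ≤ I b := by
    intro a b ha hab
    refine intervalIntegral.integral_mono_on (by norm_num) (hint a ha) (hint b (ha.trans hab)) ?_
    intro u hu
    exact hm (mul_le_mul_of_nonneg_right hab (by linarith [hu.1]))
  have hIl : ∀ s, 0 ≤ s → h s ≤ I s := by
    intro s hs
    have := intervalIntegral.integral_mono_on (a := 1) (b := 2) (f := fun _ => h s) (by norm_num)
      (by simp) (hint s hs) (fun u hu => hm (by nlinarith [hu.1]))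
    simp at this
    linarith
  have hIu : ∀ s, 0 ≤ s → I s ≤ h (2 * s) := by
    intro s hs
    have := intervalIntegral.integral_mono_on (a := 1) (b := 2) (g := fun _ => h (2 * s))
      (by norm_num) (hint s hs)
      (by simp) (fun u hu => hm (by nlinarith [hu.2]))
    simp at this
    linarith
  have hI0 : I 0 = 0 := by simp [I, hh0]
  have hIc : ContinuousOn I (Set.Ici 0) := by
    intro s hs
    rcases (show (0:ℝ) ≤ s from hs).eq_or_lt with rfl | hs
    · rw [Metric.continuousWithinAt_iff]
      intro ε hε
      obtain ⟨δ, hδ, H⟩ := hsm (ε / 2) (by linarith)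
      refine ⟨δ / 2, by linarith, fun {x} hx hd => ?_⟩
      have hx : 0 ≤ x := hx
      rw [Real.dist_eq, hI0, sub_zero]
      rw [Real.dist_eq, sub_zero, abs_of_nonneg hx] at hd
      have a1 := hIu x hx
      have a2 := hIl x hx
      have a3 := hpos x
      have a4 : h (2 * x) ≤ h δ := hm (by linarith)
      rw [abs_of_nonneg (by linarith)]
      linarith
    · apply ContinuousAt.continuousWithinAt
      have hp := intervalIntegral.continuous_primitive (μ := MeasureTheory.volume) (f := h)
        (fun a b => hm.intervalIntegrable) 0
      have heq : I =ᶠ[nhds s] fun s => s⁻¹ * ((∫ u in (0:ℝ)..(s*2), h u) -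
          ∫ u in (0:ℝ)..s*1, h u) := by
        filter_upwards [lt_mem_nhds hs] with t ht
        rw [intervalIntegral.integral_interval_sub_left hm.intervalIntegrable hm.intervalIntegrable,
          ← intervalIntegral.mul_integral_comp_mul_left, inv_mul_cancel_left₀ ht.ne']
      refine ContinuousAt.congr ?_ heq.symm
      refine (continuousAt_inv₀ hs.ne').mul ?_
      exact ((hp.comp (continuous_id.mul continuous_const)).sub
        (hp.comp (continuous_id.mul continuous_const))).continuousAt
  refine ⟨fun s => s + I s, ⟨⟨continuousOn_id.add hIc, ?_, by simp [hI0]⟩, ?_⟩, ?_⟩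
  · intro a ha b hb hab
    have := hIm a b ha hab.le
    simp only
    linarith
  · refine Filter.tendsto_atTop_mono' _ ?_ Filter.tendsto_id
    filter_upwards [Filter.eventually_ge_atTop 0] with s hs
    have := hIl s hs
    have := hpos s
    simp only [id]
    linarith
  · intro s r hs hp
    have := hle s r hs hp
    have := hIl s hs
    simp only
    linarith

/-- KL construction -/
lemma exists_KL {a1 a2 κ : ℝ → ℝ} (h1 : ClassKInf a1) (h2 : ClassKInf a2) (hκ : ClassKInf κ) :
    ∃ β, ClassKL β ∧ ∀ s t r, 0 ≤ s → 0 ≤ t → 0 ≤ r → a1 r + t * κ r ≤ a2 s → r ≤ β s t := by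
  have hψ : ∀ t, 0 ≤ t → ClassKInf (fun r => a1 r + t * κ r) := by
    intro t ht
    refine ⟨⟨h1.1.1.add (continuousOn_const.mul hκ.1.1), ?_, by simp [h1.1.2.2, hκ.1.2.2]⟩, ?_⟩
    · intro a ha b hb hab
      have := h1.1.2.1 ha hb hab
      have := mul_le_mul_of_nonneg_left (hκ.1.mono' ha hab.le) ht
      simp only
      linarith
    · refine Filter.tendsto_atTop_mono' _ ?_ h1.2
      filter_upwards [Filter.eventually_ge_atTop 0] with s hs
      have := mul_nonneg ht (hκ.1.nonneg' hs)
      linarith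
  choose! g hg hg1 hg2 using fun t ht => (hψ t ht).inverse'
  refine ⟨fun s t => g t (a2 s), ⟨?_, ?_⟩, ?_⟩
  · intro t ht
    exact (hg t ht).1.comp' h2.1
  · intro s hs
    have ha : 0 < a2 s := by
      have := h2.1.2.1 (Set.mem_Ici.2 le_rfl) (Set.mem_Ici.2 hs.le) hs
      rwa [h2.1.2.2] at this
    have hgp : ∀ t, 0 ≤ t → 0 < g t (a2 s) := by
      intro t ht
      have := (hg t ht).1.2.1 (Set.mem_Ici.2 le_rfl) (Set.mem_Ici.2 ha.le) ha
      rwa [(hg t ht).1.2.2] at this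
    have hkp : ∀ r, 0 < r → 0 < κ r := by
      intro r hr
      have := hκ.1.2.1 (Set.mem_Ici.2 le_rfl) (Set.mem_Ici.2 hr.le) hr
      rwa [hκ.1.2.2] at this
    constructor
    · intro t ht t' ht' htt
      simp only
      by_contra hc
      push Not at hc
      have e1 := (hg1 t ht _ ha.le).2
      have e2 := (hg1 t' ht' _ ha.le).2
      have b1 := (hψ t ht).1.mono' (hgp t ht).le hc
      have := mul_lt_mul_of_pos_right htt (hkp _ (hgp t' ht'))
      linarith
    · rw [Metric.tendsto_atTop]
      intro ε hε
      refine ⟨max 0 (a2 s / κ ε), fun t ht => ?_⟩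
      have ht0 : 0 ≤ t := (le_max_left _ _).trans ht
      have ht1 : a2 s / κ ε ≤ t := (le_max_right _ _).trans ht
      rw [Real.dist_eq, sub_zero, abs_of_pos (hgp t ht0)]
      by_contra hc
      push Not at hc
      have e1 := (hg1 t ht0 _ ha.le).2
      have b1 := (hψ t ht0).1.mono' hε.le hc
      have b2 : 0 < a1 ε := by
        have := h1.1.2.1 (Set.mem_Ici.2 le_rfl) (Set.mem_Ici.2 hε.le) hε
        rwa [h1.1.2.2] at this
      rw [div_le_iff₀ (hkp ε hε)] at ht1
      linarith
  · intro s t r hs ht hr hle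
    have := (hg t ht).1.mono' ((hψ t ht).1.nonneg' hr) hle
    rwa [hg2 t ht r hr] at this

lemma le_bsup (e : ℕ → ℝ) (he : ∀ i, 0 ≤ e i) (k i : ℕ) (hi : i < k) :
    e i ≤ ⨆ i ∈ Finset.range k, e i := by
  have hb : BddAbove (Set.range fun i => ⨆ (_ : i ∈ Finset.range k), e i) := by
    refine ⟨∑ j ∈ Finset.range k, e j, ?_⟩
    rintro _ ⟨j, rfl⟩
    simp only
    by_cases hj : j ∈ Finset.range k
    · rw [ciSup_pos hj]
      exact Finset.single_le_sum (fun i _ => he i) hj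
    · simp only [hj, Real.iSup_of_isEmpty]
      exact Finset.sum_nonneg fun i _ => he i
  have := le_ciSup hb i
  rwa [ciSup_pos (Finset.mem_range.2 hi)] at this

theorem statement8 {n q : ℕ}
    (F : EuclideanSpace ℝ (Fin n) → EuclideanSpace ℝ (Fin q) → ℝ → EuclideanSpace ℝ (Fin n))
    (hzero : ∃ Tr, 0 < Tr ∧ ∀ T : ℝ, 0 < T → T < Tr → F 0 0 T = 0)
    (hcont : ∃ Th, 0 < Th ∧ ∀ ε, 0 < ε → ∃ δ, 0 < δ ∧
      ∀ (x : EuclideanSpace ℝ (Fin n)) (e : EuclideanSpace ℝ (Fin q)) (T : ℝ),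
        ‖x‖ ≤ δ → ‖e‖ ≤ δ → 0 < T → T < Th → ‖F x e T‖ < ε)
    (hbound : ∃ C Tc : ℝ → ℝ → ℝ,
      (∀ M, 0 ≤ M → ∀ Eb, 0 ≤ Eb → 0 < C M Eb) ∧
      (∀ M₁ M₂ E₁ E₂, 0 ≤ M₁ → M₁ ≤ M₂ → 0 ≤ E₁ → E₁ ≤ E₂ → C M₁ E₁ ≤ C M₂ E₂) ∧
      (∀ M, 0 ≤ M → ∀ Eb, 0 ≤ Eb → 0 < Tc M Eb) ∧
      (∀ M₁ M₂ E₁ E₂, 0 ≤ M₁ → M₁ ≤ M₂ → 0 ≤ E₁ → E₁ ≤ E₂ → Tc M₂ E₂ ≤ Tc M₁ E₁) ∧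
      ∀ M, 0 ≤ M → ∀ Eb, 0 ≤ Eb →
        ∀ (x : EuclideanSpace ℝ (Fin n)) (e : EuclideanSpace ℝ (Fin q)) (T : ℝ),
          ‖x‖ ≤ M → ‖e‖ ≤ Eb → 0 < T → T < Tc M Eb → ‖F x e T‖ ≤ C M Eb)
    (hlyap : ∃ α₁ α₂ α₃ ρ : ℝ → ℝ,
      ClassKInf α₁ ∧ ClassKInf α₂ ∧ ClassKInf α₃ ∧ ClassK ρ ∧
      ∃ Tt : ℝ → ℝ → ℝ,
        (∀ M, 0 ≤ M → ∀ Eb, 0 ≤ Eb → 0 < Tt M Eb) ∧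
        (∀ M₁ M₂ E₁ E₂, 0 ≤ M₁ → M₁ ≤ M₂ → 0 ≤ E₁ → E₁ ≤ E₂ → Tt M₂ E₂ ≤ Tt M₁ E₁) ∧
        ∀ M, 0 ≤ M → ∀ Eb, 0 ≤ Eb →
          ∃ V : EuclideanSpace ℝ (Fin n) → ENNReal,
            (∀ x : EuclideanSpace ℝ (Fin n), ENNReal.ofReal (α₁ ‖x‖) ≤ V x) ∧
            (∀ x : EuclideanSpace ℝ (Fin n), ‖x‖ ≤ M → V x ≤ ENNReal.ofReal (α₂ ‖x‖)) ∧
            (∀ (x : EuclideanSpace ℝ (Fin n)) (e : EuclideanSpace ℝ (Fin q)) (T : ℝ),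
              ρ ‖e‖ ≤ ‖x‖ → ‖x‖ ≤ M → ‖e‖ ≤ Eb → 0 < T → T < Tt M Eb →
              V (F x e T) + ENNReal.ofReal (T * α₃ ‖x‖) ≤ V x)) :
    SISSVSR F := by
  obtain ⟨Th, hTh, hcont⟩ := hcont
  obtain ⟨C, Tc, -, hCm, hTc, hTcm, hbound⟩ := hbound
  obtain ⟨α₁, α₂, α₃, ρ, h1, h2, h3, hρ, Tt, hTt, hTtm, hV⟩ := hlyap
  obtain ⟨ζ, hζ, hζb⟩ := exists_kinf_bound (fun s r => ∃ (x : EuclideanSpace ℝ (Fin n))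
      (e : EuclideanSpace ℝ (Fin q)) (T : ℝ), ‖e‖ = s ∧ ‖x‖ ≤ ρ s ∧ 0 < T ∧ T < Th ∧
        T < Tc (ρ s) s ∧ r = ‖F x e T‖) (by
    intro s hs
    refine ⟨C (ρ s) s, ?_⟩
    rintro s' r hs' hss ⟨x, e, T, he, hx, hT, hT1, hT2, rfl⟩
    have hr := hρ.nonneg' hs'
    exact (hbound (ρ s') hr s' hs' x e T hx he.le hT hT2).trans
      (hCm _ _ _ _ hr (hρ.mono' hs' hss) hs' hss)) (by
    intro ε hε
    obtain ⟨δ, hδ, H⟩ := hcont ε hε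
    obtain ⟨d, hd, Hd⟩ := Metric.continuousWithinAt_iff.1 (hρ.1 0 (Set.mem_Ici.2 le_rfl)) δ hδ
    refine ⟨min δ (d / 2), by positivity, ?_⟩
    rintro s' r hs' hss ⟨x, e, T, he, hx, hT, hT1, hT2, rfl⟩
    have h5 := hss.trans (min_le_left _ _)
    have h6 := hss.trans (min_le_right _ _)
    have h7 := Hd (Set.mem_Ici.2 hs') (by
      rw [Real.dist_eq, sub_zero, abs_of_nonneg hs']; linarith)
    rw [Real.dist_eq, hρ.2.2, sub_zero] at h7
    have h8 := le_abs_self (ρ s')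
    exact (H x e T (by linarith) (by linarith) hT hT1).le)
  obtain ⟨g1, hg1, hg1a, hg1b⟩ := h1.inverse'
  obtain ⟨g2, hg2, hg2a, hg2b⟩ := h2.inverse'
  have hκ' : ClassKInf (fun v => α₃ (g2 v)) := h3.comp' hg2
  obtain ⟨β, hβ, hβb⟩ := exists_KL h1 h2 (hκ'.comp' h1)
  refine ⟨β, fun s => g1 (α₂ (ζ s)), hβ, hg1.comp' (h2.comp' hζ), ?_⟩
  intro M hM Eb hE
  have hζE := hζ.1.nonneg' hE
  let m := max M (ζ Eb)
  let B := α₂ m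
  let M' := max m (g1 B)
  have hm0 : 0 ≤ m := hM.trans (le_max_left _ _)
  have hmM : m ≤ M' := le_max_left _ _
  have hB0 : 0 ≤ B := h2.1.nonneg' hm0
  have hM'0 : 0 ≤ M' := hm0.trans hmM
  have hρE := hρ.nonneg' hE
  obtain ⟨V, hV1, hV2, hV3⟩ := hV M' hM'0 Eb hE
  refine ⟨min (Tt M' Eb) (min Th (Tc (ρ Eb) Eb)),
    lt_min (hTt _ hM'0 _ hE) (lt_min hTh (hTc _ hρE _ hE)), ?_⟩
  intro x e T hx hx0 he hT k
  have hTa : ∀ i, T i < Tt M' Eb := fun i => (hT i).2.trans_le (min_le_left _ _)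
  have hTb : ∀ i, T i < Th := fun i => (hT i).2.trans_le
    ((min_le_right _ _).trans (min_le_left _ _))
  have hTd : ∀ i, T i < Tc (ρ Eb) Eb := fun i => (hT i).2.trans_le
    ((min_le_right _ _).trans (min_le_right _ _))
  -- the two cases for a step
  have hstepB : ∀ i, ¬ (ρ ‖e i‖ ≤ ‖x i‖) →
      V (x (i + 1)) ≤ ENNReal.ofReal (α₂ (ζ ‖e i‖)) ∧ ζ ‖e i‖ ≤ m := by
    intro i hi
    push Not at hi
    have ha : ‖x (i + 1)‖ ≤ ζ ‖e i‖ := hζb ‖e i‖ _ (norm_nonneg _)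
      ⟨x i, e i, T i, rfl, hi.le, (hT i).1, hTb i, (hTd i).trans_le
        (hTcm _ _ _ _ (hρ.nonneg' (norm_nonneg _)) (hρ.mono' (norm_nonneg _) (he i))
          (norm_nonneg _) (he i)), by rw [hx i]⟩
    have hb : ζ ‖e i‖ ≤ m := (hζ.1.mono' (norm_nonneg _) (he i)).trans (le_max_right _ _)
    exact ⟨(hV2 _ (ha.trans (hb.trans hmM))).trans
      (ENNReal.ofReal_le_ofReal (h2.1.mono' (norm_nonneg _) ha)), hb⟩
  have hVM : ∀ y, V y ≤ ENNReal.ofReal B → ‖y‖ ≤ M' := by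
    intro y hy
    have h5 := (ENNReal.ofReal_le_ofReal_iff hB0).1 ((hV1 y).trans hy)
    have h6 := hg1.1.mono' (h1.1.nonneg' (norm_nonneg _)) h5
    rw [hg1b _ (norm_nonneg _)] at h6
    exact h6.trans (le_max_right _ _)
  have hinv : ∀ i, V (x i) ≤ ENNReal.ofReal B := by
    intro i
    induction i with
    | zero =>
      have h5 : ‖x 0‖ ≤ m := hx0.trans (le_max_left _ _)
      exact (hV2 _ (h5.trans hmM)).trans
        (ENNReal.ofReal_le_ofReal (h2.1.mono' (norm_nonneg _) h5))
    | succ i ih =>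
      by_cases hc : ρ ‖e i‖ ≤ ‖x i‖
      · have h5 := hV3 (x i) (e i) (T i) hc (hVM _ ih) (he i) (hT i).1 (hTa i)
        rw [← hx i] at h5
        exact (le_self_add.trans h5).trans ih
      · obtain ⟨h5, h6⟩ := hstepB i hc
        exact h5.trans (ENNReal.ofReal_le_ofReal (h2.1.mono' (hζ.1.nonneg' (norm_nonneg _)) h6))
  have hxM : ∀ i, ‖x i‖ ≤ M' := fun i => hVM _ (hinv i)
  let v : ℕ → ℝ := fun i => (V (x i)).toReal
  have hvV : ∀ i, V (x i) = ENNReal.ofReal (v i) := fun i =>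
    (ENNReal.ofReal_toReal (ne_top_of_le_ne_top ENNReal.ofReal_ne_top (hinv i))).symm
  have hv0 : ∀ i, 0 ≤ v i := fun i => ENNReal.toReal_nonneg
  have hv1 : ∀ i, α₁ ‖x i‖ ≤ v i := fun i => by
    have := hV1 (x i)
    rw [hvV] at this
    exact (ENNReal.ofReal_le_ofReal_iff (hv0 i)).1 this
  have hv2 : ∀ i, v i ≤ α₂ ‖x i‖ := fun i => by
    have := hV2 (x i) (hxM i)
    rw [hvV] at this
    exact (ENNReal.ofReal_le_ofReal_iff (h2.1.nonneg' (norm_nonneg _))).1 this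
  have hg2x : ∀ i, α₃ (g2 (v i)) ≤ α₃ ‖x i‖ := fun i => by
    have := hg2.1.mono' (hv0 i) (hv2 i)
    rw [hg2b _ (norm_nonneg _)] at this
    exact h3.1.mono' (hg2a _ (hv0 i)).1 this
  have hs0 : ∀ k, 0 ≤ ⨆ i ∈ Finset.range k, ‖e i‖ := fun k =>
    Real.iSup_nonneg fun i => Real.iSup_nonneg fun _ => norm_nonneg _
  have hsm : ∀ k, (⨆ i ∈ Finset.range k, ‖e i‖) ≤ ⨆ i ∈ Finset.range (k + 1), ‖e i‖ := by
    intro k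
    refine Real.iSup_le (fun i => Real.iSup_le (fun hi => ?_) (hs0 _)) (hs0 _)
    exact le_bsup (fun i => ‖e i‖) (fun i => norm_nonneg _) (k + 1) i
      ((Finset.mem_range.1 hi).trans (Nat.lt_succ_self k))
  have ht0 : ∀ k, 0 ≤ ∑ i ∈ Finset.range k, T i := fun k =>
    Finset.sum_nonneg fun i _ => (hT i).1.le
  have main : ∀ k, v k + (∑ i ∈ Finset.range k, T i) * α₃ (g2 (v k)) ≤ v 0 ∨
      v k ≤ α₂ (ζ (⨆ i ∈ Finset.range k, ‖e i‖)) := by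
    intro k
    induction k with
    | zero => left; simp
    | succ k ih =>
      by_cases hc : ρ ‖e k‖ ≤ ‖x k‖
      · have h5 := hV3 (x k) (e k) (T k) hc (hxM k) (he k) (hT k).1 (hTa k)
        have h30 : 0 ≤ T k * α₃ ‖x k‖ := mul_nonneg (hT k).1.le (h3.1.nonneg' (norm_nonneg _))
        rw [← hx k, hvV, hvV, ← ENNReal.ofReal_add (hv0 _) h30,
          ENNReal.ofReal_le_ofReal_iff (hv0 k)] at h5
        have h6 : v (k + 1) ≤ v k := by linarith
        rcases ih with ih | ih
        · left
          have h7 : α₃ (g2 (v (k + 1))) ≤ α₃ (g2 (v k)) := hκ'.1.mono' (hv0 _) h6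
          have h8 := mul_le_mul_of_nonneg_left h7 (ht0 k)
          have h9 := mul_le_mul_of_nonneg_left (h7.trans (hg2x k)) (hT k).1.le
          rw [Finset.sum_range_succ, add_mul]
          linarith
        · right
          exact (h6.trans ih).trans (h2.1.mono' (hζ.1.nonneg' (hs0 k)) (hζ.1.mono' (hs0 k) (hsm k)))
      · right
        obtain ⟨h5, -⟩ := hstepB k hc
        rw [hvV, ENNReal.ofReal_le_ofReal_iff (h2.1.nonneg' (hζ.1.nonneg' (norm_nonneg _)))] at h5
        refine h5.trans (h2.1.mono' (hζ.1.nonneg' (norm_nonneg _)) (hζ.1.mono' (norm_nonneg _) ?_))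
        exact le_bsup (fun i => ‖e i‖) (fun i => norm_nonneg _) (k + 1) k (Nat.lt_succ_self k)
  have hβ0 : 0 ≤ β ‖x 0‖ (∑ i ∈ Finset.range k, T i) :=
    ClassK.nonneg' (hβ.1 _ (ht0 k)) (norm_nonneg _)
  have hγ0 : 0 ≤ g1 (α₂ (ζ (⨆ i ∈ Finset.range k, ‖e i‖))) :=
    (hg1.comp' (h2.comp' hζ)).1.nonneg' (hs0 k)
  simp only
  rcases main k with h5 | h5
  · have h6 := hκ'.1.mono' (h1.1.nonneg' (norm_nonneg _)) (hv1 k)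
    have h7 := mul_le_mul_of_nonneg_left h6 (ht0 k)
    have h8 := hβb ‖x 0‖ (∑ i ∈ Finset.range k, T i) ‖x k‖ (norm_nonneg _) (ht0 k)
      (norm_nonneg _) (by
        have := hv1 k
        have := hv2 0
        linarith)
    linarith
  · have h6 := hg1.1.mono' (h1.1.nonneg' (norm_nonneg _)) ((hv1 k).trans h5)
    rw [hg1b _ (norm_nonneg _)] at h6
    linarith
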